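/- arXiv:1311.4477 — 2 statements merged into one kernel-verified Lean document; each statement's English description precedes it below -/
import Mathlib

section
/- Let p ≥ 3 and let f(x) = λx + Σ_{i≥2} a_i x^i ∈ 𝒪_p[[x]] with λ not a root of unity, 1/p < |1-λ| < 1, |a₂| = 1 and |a₂² - a₃| = 1, and set r(f) = |1-λ|^{-1/p} · r̃(λ). Then the boundary sphere S_{r(f)}(0) of the linearization disk Δ_f = D_{r(f)}(0) contains no periodic point of f: for every x ∈ ℂ_p with |x| = r(f) and every integer n ≥ 1, f^{∘n}(x) ≠ x. -/
open scoped BigOperators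

noncomputable section

/-- `R(s) = p^{-1/(p^{s-1}(p-1))}` for `s ≥ 1`, and `R(0) = 0`. -/
def Rr (p : ℕ) (s : ℕ) : ℝ :=
  if s = 0 then 0 else (p : ℝ) ^ (-(1 : ℝ) / ((p : ℝ) ^ (s - 1) * ((p : ℝ) - 1)))

/-- The group `Γ_r` of `p`-power roots of unity. -/
def GammaR (p : ℕ) (K : Type*) [Monoid K] : Set K := {z | ∃ k : ℕ, z ^ p ^ k = 1}

/-- The quantity `r̃(λ)`. -/
def rTilde {K : Type*} [NontriviallyNormedField K] (p : ℕ) (lam γ₀ : K) (m s t : ℕ) : ℝ :=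
  Rr p (s + 1) ^ ((1 : ℝ) / m) *
    (p : ℝ) ^ (-(((s : ℝ) - (t : ℝ)) / ((m : ℝ) * (p : ℝ) ^ s))) *
    ‖1 - lam ^ m‖ ^ ((s : ℝ) * ((p : ℝ) - 1) / ((m : ℝ) * (p : ℝ))) *
    ‖γ₀ - lam ^ m‖ ^ ((1 : ℝ) / ((m : ℝ) * (p : ℝ) ^ ((s : ℝ) - (t : ℝ))))

/-- Coefficient of `x^k` in the formal composition `H ∘ F`, where `H, F` are given by their
coefficient sequences `b, c` and `F` has zero constant term. -/
def compCoeff {K : Type*} [Field K] (b c : ℕ → K) (k : ℕ) : K :=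
  ∑ l ∈ Finset.range (k + 1), b l * PowerSeries.coeff k ((PowerSeries.mk c) ^ l)

/-- `b` is (the coefficient sequence of) the normalized formal linearizing conjugacy `H_f` for the
power series `f` with coefficient sequence `c`: `H(0)=0`, `H'(0)=1` and `H ∘ f = λ·H` as formal
power series. -/
def IsConjugacy {K : Type*} [Field K] (lam : K) (c b : ℕ → K) : Prop :=
  b 0 = 0 ∧ b 1 = 1 ∧ ∀ k, compCoeff b c k = lam * b k

/-- Evaluation of the power series with coefficients `b` at `x`. -/
def pEval {K : Type*} [NontriviallyNormedField K] (b : ℕ → K) (x : K) : K :=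
  ∑' k, b k * x ^ k

/-- `f` is analytically linearizable on `U` (a disk about `0`): `f` maps `U` to itself and some
convergent power series `h` with `h(0)=0`, `h'(0)=1` maps `U` bijectively onto itself and
conjugates `f` to `x ↦ λx` on `U`. -/
def LinearizableOn {K : Type*} [NontriviallyNormedField K] (f : K → K) (lam : K)
    (U : Set K) : Prop :=
  Set.MapsTo f U U ∧
    ∃ b : ℕ → K, b 0 = 0 ∧ b 1 = 1 ∧
      (∀ x ∈ U, Summable fun k => b k * x ^ k) ∧
      Set.BijOn (pEval b) U U ∧
      ∀ x ∈ U, pEval b (f x) = lam * pEval b x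

/-- A disk about `0`: an open or closed ball centered at the origin. -/
def IsZeroDisk {K : Type*} [NontriviallyNormedField K] (U : Set K) : Prop :=
  ∃ ρ : ℝ, U = Metric.ball (0 : K) ρ ∨ U = Metric.closedBall (0 : K) ρ

/-- `x` is a periodic point of `f` of minimal period `q`. -/
def IsMinPeriodicPt {K : Type*} (f : K → K) (q : ℕ) (x : K) : Prop :=
  f^[q] x = x ∧ ∀ j, 1 ≤ j → j < q → f^[j] x ≠ x

/-- The valuation `ν(x) = -log_p |x|`. -/
def nuP {K : Type*} [NontriviallyNormedField K] (p : ℕ) (z : K) : ℝ :=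
  -Real.logb p ‖z‖

/-- `κ_n = -(ν(1-λ^{p^n}) - ν(1-λ^{p^{n-1}}))/p^n`. -/
def kappaN {K : Type*} [NontriviallyNormedField K] (p : ℕ) (lam : K) (n : ℕ) : ℝ :=
  -(nuP p (1 - lam ^ p ^ n) - nuP p (1 - lam ^ p ^ (n - 1))) / (p : ℝ) ^ n

open Classical in
/-- The multiplicity of `x` as a zero of the analytic function `g`. -/
def analyticMult {K : Type*} [NontriviallyNormedField K] (g : K → K) (x : K) : ℕ :=
  if h : AnalyticAt K g x then (analyticOrderAt g x).toNat else 0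

/-- The radius `r(P_λ) = |1-λ|^{-1/p}·r̃(λ)` of quadratic linearization disks. -/
def rQuad {K : Type*} [NontriviallyNormedField K] (p : ℕ) (lam γ₀ : K) (m s t : ℕ) : ℝ :=
  ‖1 - lam‖ ^ (-(1 : ℝ) / (p : ℝ)) * rTilde p lam γ₀ m s t

/-- The quantity `Ψ(λ) = |1-λ|^{-1/p}·p^{-(s-t)/p^s}·|γ₀-λ|^{1/p^{s-t}}` (case `m = 1`). -/
def PsiL {K : Type*} [NontriviallyNormedField K] (p : ℕ) (lam γ₀ : K) (s t : ℕ) : ℝ :=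
  ‖1 - lam‖ ^ (-(1 : ℝ) / (p : ℝ)) *
    (p : ℝ) ^ (-(((s : ℝ) - (t : ℝ)) / (p : ℝ) ^ s)) *
    ‖γ₀ - lam‖ ^ ((1 : ℝ) / (p : ℝ) ^ ((s : ℝ) - (t : ℝ)))

/-- Coefficient sequence of the quadratic polynomial `P_λ(x) = λx + x²`. -/
def quadCoeff {K : Type*} [Field K] (lam : K) : ℕ → K :=
  fun i => if i = 1 then lam else if i = 2 then 1 else 0

/-- `δ(z) = (k-1)/z - ⌊(k-1)/z⌋` as a rational number. -/
def deltaFrac (k z : ℕ) : ℚ :=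
  ((k : ℚ) - 1) / (z : ℚ) - (((k - 1) / z : ℕ) : ℚ)

end

section Analytic

variable {K : Type*} [NontriviallyNormedField K]

lemma summable_norm_pEval {b : ℕ → K} (hb : ∀ i, ‖b i‖ ≤ 1) {x : K} (hx : ‖x‖ < 1) :
    Summable fun k => ‖b k * x ^ k‖ := by
  refine Summable.of_nonneg_of_le (fun _ => norm_nonneg _) (fun k => ?_)
    (summable_geometric_of_lt_one (norm_nonneg x) hx)
  rw [norm_mul, norm_pow]
  exact mul_le_of_le_one_left (by positivity) (hb k)

lemma coeff_pow_eq_zero_of_lt {c : ℕ → K} (hc0 : c 0 = 0) {k l : ℕ} (h : k < l) :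
    PowerSeries.coeff k (PowerSeries.mk c ^ l) = 0 := by
  refine PowerSeries.X_pow_dvd_iff.mp (pow_dvd_pow_of_dvd (PowerSeries.X_dvd_iff.mpr ?_) l) k h
  rw [← PowerSeries.coeff_zero_eq_constantCoeff_apply, PowerSeries.coeff_mk, hc0]

lemma summable_pEval [CompleteSpace K] {b : ℕ → K} (hb : ∀ i, ‖b i‖ ≤ 1) {x : K} (hx : ‖x‖ < 1) :
    Summable fun k => b k * x ^ k :=
  (summable_norm_pEval hb hx).of_norm

/-- Splitting off the constant term. -/
lemma pEval_eq_add_mul_shift [CompleteSpace K] {b : ℕ → K} (hb : ∀ i, ‖b i‖ ≤ 1) {x : K} (hx : ‖x‖ < 1) :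
    pEval b x = b 0 + x * pEval (fun k => b (k + 1)) x := by
  unfold pEval
  rw [(summable_pEval hb hx).tsum_eq_zero_add, ← tsum_mul_left]
  simp only [pow_zero, mul_one, pow_succ]
  congr 2
  ext k
  ring

variable [IsUltrametricDist K]

lemma norm_pEval_le_one {b : ℕ → K} (hb : ∀ i, ‖b i‖ ≤ 1) {x : K} (hx : ‖x‖ < 1) :
    ‖pEval b x‖ ≤ 1 := by
  refine IsUltrametricDist.norm_tsum_le_of_forall_le_of_nonneg zero_le_one fun k => ?_
  rw [norm_mul, norm_pow]
  exact mul_le_one₀ (hb k) (by positivity) (pow_le_one₀ (norm_nonneg _) hx.le)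

lemma norm_coeff_pow_le_one {F : PowerSeries K} (hF : ∀ i, ‖PowerSeries.coeff i F‖ ≤ 1) (l : ℕ) :
    ∀ i, ‖PowerSeries.coeff i (F ^ l)‖ ≤ 1 := by
  induction l with
  | zero =>
    intro i
    rw [pow_zero, PowerSeries.coeff_one]
    split_ifs <;> simp
  | succ l ih =>
    intro i
    rw [pow_succ, PowerSeries.coeff_mul]
    refine IsUltrametricDist.norm_sum_le_of_forall_le_of_nonneg zero_le_one fun j _ => ?_
    rw [norm_mul]
    exact mul_le_one₀ (ih _) (norm_nonneg _) (hF _)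

lemma norm_compCoeff_le_one {b c : ℕ → K} (hb : ∀ i, ‖b i‖ ≤ 1) (hc : ∀ i, ‖c i‖ ≤ 1) (k : ℕ) :
    ‖compCoeff b c k‖ ≤ 1 := by
  refine IsUltrametricDist.norm_sum_le_of_forall_le_of_nonneg zero_le_one fun l _ => ?_
  rw [norm_mul]
  exact mul_le_one₀ (hb _) (norm_nonneg _) (norm_coeff_pow_le_one (by simpa using hc) l k)

variable [CompleteSpace K]

lemma norm_pEval_le {b : ℕ → K} (hb : ∀ i, ‖b i‖ ≤ 1) (hb0 : b 0 = 0) {x : K}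
    (hx : ‖x‖ < 1) : ‖pEval b x‖ ≤ ‖x‖ := by
  rw [pEval_eq_add_mul_shift hb hx, hb0, zero_add, norm_mul]
  exact mul_le_of_le_one_right (norm_nonneg _) (norm_pEval_le_one (fun i => hb (i + 1)) hx)

/-- A power series with integral coefficients vanishing at `a` in the open unit disk is divisible
by `X - a`, with an integral quotient. -/
lemma exists_pEval_eq_sub_mul {b : ℕ → K} (hb : ∀ i, ‖b i‖ ≤ 1) {a : K} (ha : ‖a‖ < 1)
    (h0 : pEval b a = 0) :
    ∃ q : ℕ → K, (∀ i, ‖q i‖ ≤ 1) ∧ b 0 = -(a * q 0) ∧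
      ∀ x : K, ‖x‖ < 1 → pEval b x = (x - a) * pEval q x := by
  have hstep : ∀ k, pEval (fun j => b (k + j)) a
      = b k + a * pEval (fun j => b (k + 1 + j)) a := fun k => by
    rw [pEval_eq_add_mul_shift (fun i => hb (k + i)) ha]
    simp only [add_zero, add_assoc, add_comm 1]
  set q : ℕ → K := fun k => pEval (fun j => b (k + 1 + j)) a with hq
  have hq1 : ∀ i, ‖q i‖ ≤ 1 := fun i => norm_pEval_le_one (fun j => hb (i + 1 + j)) ha
  have hb0 : b 0 = -(a * q 0) := by
    have := hstep 0
    simp only [zero_add, h0] at this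
    linear_combination -this
  refine ⟨q, hq1, hb0, fun x hx => ?_⟩
  have hbs : ∀ k, b (k + 1) = q k - a * q (k + 1) := fun k => by
    linear_combination -(hstep (k + 1))
  rw [pEval_eq_add_mul_shift hb hx, hb0]
  have h2 : pEval (fun k => b (k + 1)) x = pEval q x - a * pEval (fun k => q (k + 1)) x := by
    unfold pEval
    rw [← tsum_mul_left, ← (summable_pEval hq1 hx).tsum_sub
      ((summable_pEval (fun i => hq1 (i + 1)) hx).mul_left a)]
    refine tsum_congr fun k => ?_
    simp only [hbs]
    ring
  rw [h2]
  linear_combination a * pEval_eq_add_mul_shift hq1 hx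

/-- The constant term of an integral power series is bounded by the product of any set of its
zeros in the open unit disk. -/
lemma norm_coeff_zero_le_prod_zeros (S : Finset K) :
    ∀ b : ℕ → K, (∀ i, ‖b i‖ ≤ 1) → (∀ a ∈ S, ‖a‖ < 1 ∧ pEval b a = 0) →
      ‖b 0‖ ≤ ∏ a ∈ S, ‖a‖ := by
  classical
  induction S using Finset.induction_on with
  | empty => intro b hb _; simpa using hb 0
  | insert a S haS ih =>
    intro b hb hS
    obtain ⟨ha, h0⟩ := hS a (Finset.mem_insert_self a S)
    obtain ⟨q, hq, hb0, hfac⟩ := exists_pEval_eq_sub_mul hb ha h0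
    rw [Finset.prod_insert haS, hb0, norm_neg, norm_mul]
    refine mul_le_mul_of_nonneg_left (ih q hq fun y hy => ?_) (norm_nonneg a)
    obtain ⟨hy1, hy0⟩ := hS y (Finset.mem_insert_of_mem hy)
    rw [hfac y hy1] at hy0
    exact ⟨hy1, (mul_eq_zero.mp hy0).resolve_left
      (sub_ne_zero.mpr fun h => haS (h ▸ hy))⟩

lemma pEval_coeff_pow {c : ℕ → K} (hc : ∀ i, ‖c i‖ ≤ 1) {x : K} (hx : ‖x‖ < 1) (l : ℕ) :
    pEval (fun k => PowerSeries.coeff k (PowerSeries.mk c ^ l)) x = pEval c x ^ l := by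
  have hF : ∀ i, ‖PowerSeries.coeff i (PowerSeries.mk c)‖ ≤ 1 := by simpa using hc
  induction l with
  | zero =>
    unfold pEval
    rw [tsum_eq_single 0 fun k hk => by simp [PowerSeries.coeff_one, hk]]
    simp
  | succ l ih =>
    rw [pow_succ (pEval c x), ← ih]
    unfold pEval
    rw [tsum_mul_tsum_eq_tsum_sum_antidiagonal_of_summable_norm
      (summable_norm_pEval (norm_coeff_pow_le_one hF l) hx) (summable_norm_pEval hc hx)]
    refine tsum_congr fun k => ?_
    simp only [pow_succ (PowerSeries.mk c), PowerSeries.coeff_mul, Finset.sum_mul]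
    refine Finset.sum_congr rfl fun j hj => ?_
    rw [← Finset.HasAntidiagonal.mem_antidiagonal.mp hj, PowerSeries.coeff_mk, pow_add]
    ring

/-- Evaluation of a formal composition on the open unit disk. -/
lemma pEval_compCoeff {b c : ℕ → K} (hb : ∀ i, ‖b i‖ ≤ 1) (hc : ∀ i, ‖c i‖ ≤ 1)
    (hc0 : c 0 = 0) {x : K} (hx : ‖x‖ < 1) :
    pEval (compCoeff b c) x = pEval b (pEval c x) := by
  have hF := fun l => norm_coeff_pow_le_one (F := PowerSeries.mk c) (by simpa using hc) l
  set g : ℕ → ℕ → K := fun k l => b l * PowerSeries.coeff k (PowerSeries.mk c ^ l) * x ^ k with hg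
  have hg0 : ∀ k l, l ∉ Finset.range (k + 1) → g k l = 0 := fun k l h => by
    simp only [Finset.mem_range, not_lt] at h
    simp [hg, coeff_pow_eq_zero_of_lt hc0 (Nat.lt_of_succ_le h)]
  have hgn : ∀ k l, ‖g k l‖ ≤ ‖x‖ ^ k := fun k l => by
    rw [hg, norm_mul, norm_mul, norm_pow]
    exact mul_le_of_le_one_left (by positivity) (mul_le_one₀ (hb l) (norm_nonneg _) (hF l k))
  have hrow : ∀ k, Summable fun l => ‖g k l‖ := fun k =>
    summable_of_ne_finset_zero (s := Finset.range (k + 1)) fun l h => by rw [hg0 k l h, norm_zero]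
  have hsum : Summable (Function.uncurry g) := by
    refine Summable.of_norm ((summable_prod_of_nonneg fun _ => norm_nonneg _).mpr ⟨hrow, ?_⟩)
    have h1 : Summable fun k : ℕ => ((k : ℝ) ^ 1 * ‖x‖ ^ k + ‖x‖ ^ k) :=
      (summable_pow_mul_geometric_of_norm_lt_one 1 (by simpa using hx)).add
        (summable_geometric_of_lt_one (norm_nonneg x) hx)
    refine Summable.of_nonneg_of_le (fun k => tsum_nonneg fun _ => norm_nonneg _) (fun k => ?_) h1
    simp only [Function.uncurry_apply_pair]
    rw [tsum_eq_sum (s := Finset.range (k + 1)) fun l h => by rw [hg0 k l h, norm_zero]]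
    refine (Finset.sum_le_card_nsmul _ _ _ fun l _ => hgn k l).trans (le_of_eq ?_)
    rw [Finset.card_range, nsmul_eq_mul]
    push_cast
    ring
  have hL : pEval (compCoeff b c) x = ∑' k, ∑' l, g k l := by
    refine tsum_congr fun k => ?_
    rw [tsum_eq_sum (s := Finset.range (k + 1)) (hg0 k), compCoeff, Finset.sum_mul]
  rw [hL, ← hsum.tsum_comm]
  refine tsum_congr fun l => ?_
  rw [← pEval_coeff_pow hc hx l, pEval, ← tsum_mul_left]
  refine tsum_congr fun k => ?_
  simp only [hg]
  ring

/-- On the open unit disk the iterates of `f` are given by integral power series with linear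
coefficient `λ ^ n`. -/
lemma exists_pEval_eq_iterate {c : ℕ → K} (hc : ∀ i, ‖c i‖ ≤ 1) (hc0 : c 0 = 0) (n : ℕ) :
    ∃ b : ℕ → K, (∀ i, ‖b i‖ ≤ 1) ∧ b 0 = 0 ∧ b 1 = c 1 ^ n ∧
      ∀ x : K, ‖x‖ < 1 → pEval b x = (pEval c)^[n] x := by
  induction n with
  | zero =>
    refine ⟨fun i => if i = 1 then 1 else 0, fun i => ?_, by simp, by simp, fun x _ => ?_⟩
    · dsimp only
      split_ifs <;> simp
    · unfold pEval
      rw [tsum_eq_single 1 fun k hk => by simp [hk]]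
      simp
  | succ n ih =>
    obtain ⟨b, hb, hb0, hb1, hbe⟩ := ih
    refine ⟨compCoeff b c, norm_compCoeff_le_one hb hc, ?_, ?_, fun x hx => ?_⟩
    · simp [compCoeff, hb0]
    · simp [compCoeff, Finset.sum_range_succ, hb0, hb1, pow_succ]
    · rw [pEval_compCoeff hb hc hc0 hx, Function.iterate_succ_apply,
        hbe _ ((norm_pEval_le hc hc0 hx).trans_lt hx)]

/-- A nonzero periodic point of minimal period `N` in the open unit disk cannot be too close to
the origin. (For a point that is not periodic, `N = 0` and the bound is trivial.) -/
lemma norm_one_sub_pow_minimalPeriod_le {c : ℕ → K} (hc : ∀ i, ‖c i‖ ≤ 1) (hc0 : c 0 = 0)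
    {x : K} (hx : ‖x‖ < 1) (hx0 : x ≠ 0) :
    ‖1 - c 1 ^ Function.minimalPeriod (pEval c) x‖
      ≤ ‖x‖ ^ Function.minimalPeriod (pEval c) x := by
  classical
  set N := Function.minimalPeriod (pEval c) x with hN
  have hit : ∀ i, ‖(pEval c)^[i] x‖ ≤ ‖x‖ := fun i => by
    induction i with
    | zero => simp
    | succ i ih =>
      rw [Function.iterate_succ_apply']
      exact (norm_pEval_le hc hc0 (ih.trans_lt hx)).trans ih
  have hfix : ∀ i, (pEval c)^[N] ((pEval c)^[i] x) = (pEval c)^[i] x := fun i =>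
    (Function.isPeriodicPt_minimalPeriod (pEval c) x).apply_iterate i
  have hzero : ∀ i, i ≤ N → (pEval c)^[i] x ≠ 0 := fun i hi h => by
    have h0 : pEval c 0 = 0 := by
      simpa using norm_pEval_le hc hc0 (x := 0) (by simp)
    have h1 : (pEval c)^[N - i + i] x = 0 := by
      rw [Function.iterate_add_apply, h, Function.iterate_fixed h0]
    rw [Nat.sub_add_cancel hi] at h1
    exact hx0 ((hfix 0).symm.trans h1)
  obtain ⟨b, hb, hb0, hb1, hbe⟩ := exists_pEval_eq_iterate hc hc0 N
  set d : ℕ → K := fun i => b i - if i = 1 then 1 else 0 with hd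
  have hd1 : ∀ i, ‖d i‖ ≤ 1 := fun i => by
    simp only [hd, sub_eq_add_neg]
    refine (IsUltrametricDist.norm_add_le_max _ _).trans (max_le (hb i) ?_)
    split_ifs <;> simp
  have hd0 : d 0 = 0 := by simp [hd, hb0]
  have hde : ∀ y : K, ‖y‖ < 1 → pEval d y = (pEval c)^[N] y - y := fun y hy => by
    have hX : HasSum (fun k => (if k = 1 then (1 : K) else 0) * y ^ k) y := by
      convert hasSum_single 1 (fun k hk => ?_) using 1
      · simp
      · simp [hk]
    rw [← hbe y hy]
    simp only [pEval, hd, sub_mul]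
    rw [(summable_pEval hb hy).tsum_sub hX.summable, hX.tsum_eq]
  have hinj : Set.InjOn (fun i => (pEval c)^[i] x) (Finset.range N) := by
    simpa using! Function.iterate_injOn_Iio_minimalPeriod (f := pEval c) (x := x)
  have key := norm_coeff_zero_le_prod_zeros ((Finset.range N).image fun i => (pEval c)^[i] x)
    (fun k => d (k + 1)) (fun i => hd1 (i + 1)) (fun a ha => by
      obtain ⟨i, hi, rfl⟩ := Finset.mem_image.mp ha
      have hlt := (hit i).trans_lt hx
      refine ⟨hlt, ?_⟩
      have h := hde _ hlt
      rw [pEval_eq_add_mul_shift hd1 hlt, hd0, zero_add, hfix, sub_self] at h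
      exact (mul_eq_zero.mp h).resolve_left (hzero i (Finset.mem_range.mp hi).le))
  rw [Finset.prod_image hinj] at key
  have hle : ∏ i ∈ Finset.range N, ‖(pEval c)^[i] x‖ ≤ ‖x‖ ^ N := by
    simpa using Finset.prod_le_prod (s := Finset.range N) (fun i _ => norm_nonneg _)
      (fun i _ => hit i)
  refine le_trans (le_of_eq ?_) (key.trans hle)
  simp [hd, hb1, norm_sub_rev]

end Analytic

section Radii

variable {p : ℕ}

lemma Rr_succ_eq (p s : ℕ) :
    Rr p (s + 1) = (p : ℝ) ^ (-(1 : ℝ) / ((p : ℝ) ^ s * ((p : ℝ) - 1))) := by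
  simp [Rr]

lemma Rr_succ_pos (hp : 1 < p) (s : ℕ) : 0 < Rr p (s + 1) := by
  rw [Rr_succ_eq]
  exact Real.rpow_pos_of_pos (by exact_mod_cast hp.le) _

lemma log_Rr_succ (hp : 1 < p) (s : ℕ) :
    Real.log (Rr p (s + 1)) = -(Real.log p / ((p : ℝ) ^ s * ((p : ℝ) - 1))) := by
  rw [Rr_succ_eq, Real.log_rpow (by exact_mod_cast hp.le)]
  ring

lemma Rr_succ_succ_pow (hp : 1 < p) (s : ℕ) : Rr p (s + 2) ^ p = Rr p (s + 1) := by
  have h1 : (1 : ℝ) < p := by exact_mod_cast hp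
  have h2 : (p : ℝ) - 1 ≠ 0 := by linarith
  rw [Rr_succ_eq, Rr_succ_eq, ← Real.rpow_natCast, ← Real.rpow_mul (by linarith)]
  congr 1
  field_simp
  ring

lemma Rr_one_pow (hp : 1 < p) : Rr p 1 ^ (p - 1) = (p : ℝ)⁻¹ := by
  have h1 : (1 : ℝ) < p := by exact_mod_cast hp
  have h2 : (p : ℝ) - 1 ≠ 0 := by linarith
  rw [Rr_succ_eq p 0, ← Real.rpow_natCast, ← Real.rpow_mul (by linarith), Nat.cast_sub hp.le,
    ← Real.rpow_neg_one]
  congr 1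
  field_simp
  simp

lemma Rr_lt_one (hp : 1 < p) (s : ℕ) : Rr p s < 1 := by
  have h1 : (1 : ℝ) < p := by exact_mod_cast hp
  rcases s with _ | s
  · simp [Rr]
  · rw [Rr_succ_eq]
    exact Real.rpow_lt_one_of_one_lt_of_neg h1
      (div_neg_of_neg_of_pos (by norm_num) (mul_pos (by positivity) (by linarith)))

lemma Rr_monotone (hp : 1 < p) : Monotone (Rr p) := by
  refine monotone_nat_of_le_succ fun s => ?_
  rcases s with _ | s
  · simpa [Rr] using (Rr_succ_pos hp 0).le
  · rw [← Rr_succ_succ_pow hp s]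
    exact pow_le_of_le_one (Rr_succ_pos hp _).le (Rr_lt_one hp _).le (by omega)

lemma inv_le_Rr_succ (hp : 1 < p) (s : ℕ) : (p : ℝ)⁻¹ ≤ Rr p (s + 1) := by
  refine le_trans ?_ (Rr_monotone hp (Nat.le_add_left 1 s))
  rw [← Rr_one_pow hp]
  exact pow_le_of_le_one (Rr_succ_pos hp 0).le (Rr_lt_one hp 1).le (by omega)

lemma pow_lt_inv_mul (hp : 1 < p) {a : ℝ} (h0 : 0 < a) (h : a < Rr p 1) :
    a ^ p < (p : ℝ)⁻¹ * a := by
  rw [← Rr_one_pow hp, ← pow_sub_one_mul (show p ≠ 0 by omega) a]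
  exact mul_lt_mul_of_pos_right (pow_lt_pow_left₀ h h0.le (by omega)) h0

lemma inv_mul_lt_pow (hp : 1 < p) {a : ℝ} (h : Rr p 1 < a) : (p : ℝ)⁻¹ * a < a ^ p := by
  have h0 := Rr_succ_pos hp 0
  rw [← Rr_one_pow hp, ← pow_sub_one_mul (show p ≠ 0 by omega) a]
  exact mul_lt_mul_of_pos_right (pow_lt_pow_left₀ h h0.le (by omega)) (h0.trans h)

lemma pow_pow_le_of_lt_Rr_one (hp : 1 < p) {a : ℝ} (h0 : 0 < a) (h : a < Rr p 1) (j : ℕ) :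
    a ^ p ^ j ≤ ((p : ℝ)⁻¹) ^ j * a := by
  have hp1 : (p : ℝ)⁻¹ ≤ 1 := inv_le_one_of_one_le₀ (by exact_mod_cast hp.le)
  induction j with
  | zero => simp
  | succ j ih =>
    have hlt : a ^ p ^ j < Rr p 1 :=
      (pow_le_of_le_one h0.le (h.trans (Rr_lt_one hp 1)).le (by positivity)).trans_lt h
    calc a ^ p ^ (j + 1) = (a ^ p ^ j) ^ p := by rw [← pow_mul, pow_succ]
      _ ≤ (p : ℝ)⁻¹ * a ^ p ^ j := (pow_lt_inv_mul hp (by positivity) hlt).le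
      _ ≤ (p : ℝ)⁻¹ * (((p : ℝ)⁻¹) ^ j * a) := by gcongr
      _ = ((p : ℝ)⁻¹) ^ (j + 1) * a := by ring

end Radii

section Arithmetic

variable {p : ℕ} {K : Type*} [NontriviallyNormedField K]

lemma pow_le_norm_one_sub_pow_pow [IsAlgClosed K] (hp : p.Prime) {y : K} {B : ℝ} (hB : 0 ≤ B)
    (h : ∀ ζ ∈ GammaR p K, B ≤ ‖ζ - y‖) (k : ℕ) : B ^ p ^ k ≤ ‖1 - y ^ p ^ k‖ := by
  have hne : p ^ k ≠ 0 := pow_ne_zero _ hp.ne_zero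
  set f : Polynomial K := Polynomial.X ^ p ^ k - Polynomial.C 1 with hf
  have hmon : f.Monic := Polynomial.monic_X_pow_sub_C 1 hne
  have hsplit : f.Splits := IsAlgClosed.splits f
  have hev : f.eval y = y ^ p ^ k - 1 := by simp [hf]
  have hcard : f.roots.card = p ^ k := by
    rw [← hsplit.natDegree_eq_card_roots, Polynomial.natDegree_X_pow_sub_C]
  have hroots : ∀ ζ ∈ f.roots, B ≤ ‖y - ζ‖ := fun ζ hζ => by
    rw [norm_sub_rev]
    refine h ζ ⟨k, ?_⟩
    have := (Polynomial.mem_roots'.mp hζ).2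
    simpa [hf, Polynomial.IsRoot, sub_eq_zero] using this
  rw [norm_sub_rev, ← hev, hsplit.eval_eq_prod_roots_of_monic hmon, ← hcard]
  generalize f.roots = S at hroots
  induction S using Multiset.induction_on with
  | empty => simp
  | cons a S ih =>
    rw [Multiset.card_cons, pow_succ', Multiset.map_cons, Multiset.prod_cons, norm_mul]
    exact mul_le_mul (hroots a (Multiset.mem_cons_self a S))
      (ih fun ζ hζ => hroots ζ (Multiset.mem_cons_of_mem hζ)) (by positivity) (norm_nonneg _)

variable [IsUltrametricDist K]

/-- If `‖1 - y‖ < 1`, then `1 - y ^ p` is, up to sign, the sum of `z ^ p` and of a term of norm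
`‖p‖ * ‖z‖`, where `z = y - 1`. -/
lemma exists_pow_prime_sub_one_eq (hp : p.Prime) {y : K} (hy : ‖1 - y‖ < 1) :
    ∃ w : K, ‖w‖ = 1 ∧ y ^ p - 1 = (y - 1) ^ p + p * ((y - 1) * w) := by
  set z := y - 1 with hz
  have hz1 : ‖z‖ < 1 := by rwa [hz, norm_sub_rev]
  refine ⟨∑ k ∈ Finset.Ioo 0 p, z ^ (k - 1) * 1 ^ (p - k - 1) * ((p.choose k / p : ℕ) : K), ?_, by
    rw [show y = z + 1 by rw [hz]; ring, add_pow_prime_eq hp z 1]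
    ring⟩
  have hIoo : Finset.Ioo 0 p = insert 1 (Finset.Ioo 1 p) := by
    have := hp.one_lt
    ext k
    simp only [Finset.mem_Ioo, Finset.mem_insert]
    omega
  rw [hIoo, Finset.sum_insert (by simp), Nat.choose_one_right, Nat.div_self hp.pos]
  have hrest : ‖∑ k ∈ Finset.Ioo 1 p, z ^ (k - 1) * 1 ^ (p - k - 1) * ((p.choose k / p : ℕ) : K)‖
      ≤ ‖z‖ := by
    refine IsUltrametricDist.norm_sum_le_of_forall_le_of_nonneg (norm_nonneg z) fun k hk => ?_
    rw [one_pow, mul_one, norm_mul, norm_pow]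
    have hk1 := (Finset.mem_Ioo.mp hk).1
    exact (mul_le_of_le_one_right (by positivity)
      (IsUltrametricDist.norm_natCast_le_one K _)).trans
      (pow_le_of_le_one (norm_nonneg z) hz1.le (by omega))
  simp only [Nat.sub_self, pow_zero, one_pow, mul_one, Nat.cast_one] at hrest ⊢
  rw [IsUltrametricDist.norm_add_eq_max_of_norm_ne_norm
    (by rw [norm_one]; exact (hrest.trans_lt hz1).ne'), norm_one]
  exact max_eq_left (hrest.trans hz1.le)

lemma norm_one_sub_pow_prime_of_lt (hp : p.Prime) (hpn : ‖(p : K)‖ = (p : ℝ)⁻¹) {y : K}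
    (hy : ‖1 - y‖ < Rr p 1) : ‖1 - y ^ p‖ = (p : ℝ)⁻¹ * ‖1 - y‖ := by
  rcases eq_or_ne y 1 with rfl | hy1
  · simp
  obtain ⟨w, hw, h⟩ := exists_pow_prime_sub_one_eq hp (hy.trans (Rr_lt_one hp.one_lt 1))
  have hlt := pow_lt_inv_mul hp.one_lt (norm_pos_iff.mpr (sub_ne_zero.mpr hy1.symm)) hy
  have h2 : ‖(p : K) * ((y - 1) * w)‖ = (p : ℝ)⁻¹ * ‖1 - y‖ := by
    rw [norm_mul, norm_mul, hw, hpn, mul_one, norm_sub_rev]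
  have h1 : ‖(y - 1) ^ p‖ = ‖1 - y‖ ^ p := by rw [norm_pow, norm_sub_rev]
  rw [norm_sub_rev, h, IsUltrametricDist.norm_add_eq_max_of_norm_ne_norm
    (by rw [h1, h2]; exact hlt.ne),
    h1, h2, max_eq_right hlt.le]

lemma norm_one_sub_pow_prime_of_gt (hp : p.Prime) (hpn : ‖(p : K)‖ = (p : ℝ)⁻¹) {y : K}
    (hy1 : ‖1 - y‖ < 1) (hy : Rr p 1 < ‖1 - y‖) : ‖1 - y ^ p‖ = ‖1 - y‖ ^ p := by
  obtain ⟨w, hw, h⟩ := exists_pow_prime_sub_one_eq hp hy1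
  have hlt := inv_mul_lt_pow hp.one_lt hy
  have h2 : ‖(p : K) * ((y - 1) * w)‖ = (p : ℝ)⁻¹ * ‖1 - y‖ := by
    rw [norm_mul, norm_mul, hw, hpn, mul_one, norm_sub_rev]
  have h1 : ‖(y - 1) ^ p‖ = ‖1 - y‖ ^ p := by rw [norm_pow, norm_sub_rev]
  rw [norm_sub_rev, h, IsUltrametricDist.norm_add_eq_max_of_norm_ne_norm
    (by rw [h1, h2]; exact hlt.ne'),
    h1, h2, max_eq_left hlt.le]

lemma norm_one_sub_pow_prime_lt (hp : p.Prime) (hpn : ‖(p : K)‖ = (p : ℝ)⁻¹) {y : K} {t : ℕ}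
    (hy : ‖1 - y‖ < Rr p (t + 2)) : ‖1 - y ^ p‖ < Rr p (t + 1) := by
  have hy1 := hy.trans (Rr_lt_one hp.one_lt _)
  obtain ⟨w, hw, h⟩ := exists_pow_prime_sub_one_eq hp hy1
  rw [norm_sub_rev, h]
  refine (IsUltrametricDist.norm_add_le_max _ _).trans_lt (max_lt ?_ ?_)
  · rw [norm_pow, norm_sub_rev, ← Rr_succ_succ_pow hp.one_lt]
    exact pow_lt_pow_left₀ hy (norm_nonneg _) hp.ne_zero
  · rw [norm_mul, norm_mul, hw, hpn, mul_one, norm_sub_rev]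
    have : (0 : ℝ) < (p : ℝ)⁻¹ := by simpa using hp.pos
    exact (mul_lt_of_lt_one_right this hy1).trans_le (inv_le_Rr_succ hp.one_lt t)

lemma norm_one_sub_pow_pow_lt (hp : p.Prime) (hpn : ‖(p : K)‖ = (p : ℝ)⁻¹) (t : ℕ) :
    ∀ y : K, ‖1 - y‖ < Rr p (t + 1) → ‖1 - y ^ p ^ t‖ < Rr p 1 := by
  induction t with
  | zero => simp
  | succ t ih =>
    intro y hy
    rw [pow_succ', pow_mul]
    exact ih _ (norm_one_sub_pow_prime_lt hp hpn hy)

lemma norm_one_sub_pow_pow_of_lt (hp : p.Prime) (hpn : ‖(p : K)‖ = (p : ℝ)⁻¹) (k : ℕ) :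
    ∀ y : K, ‖1 - y‖ < Rr p 1 → ‖1 - y ^ p ^ k‖ = ((p : ℝ)⁻¹) ^ k * ‖1 - y‖ := by
  have hinv : (p : ℝ)⁻¹ ≤ 1 := inv_le_one_of_one_le₀ (by exact_mod_cast hp.one_lt.le)
  induction k with
  | zero => simp
  | succ k ih =>
    intro y hy
    have h := norm_one_sub_pow_prime_of_lt hp hpn hy
    have hlt : ‖1 - y ^ p‖ < Rr p 1 :=
      (h.le.trans (mul_le_of_le_one_left (norm_nonneg _) hinv)).trans_lt hy
    rw [pow_succ', pow_mul, ih _ hlt, h]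
    ring

lemma norm_one_sub_pow_pow_of_ge (hp : p.Prime) (hpn : ‖(p : K)‖ = (p : ℝ)⁻¹) (s : ℕ) :
    ∀ y : K, ‖1 - y‖ < 1 → Rr p (s + 1) ≤ ‖1 - y‖ → ∀ n ≤ s,
      ‖1 - y ^ p ^ n‖ = ‖1 - y‖ ^ p ^ n := by
  have hp1 := hp.one_lt
  induction s with
  | zero => intro y _ _ n hn; simp [Nat.le_zero.mp hn]
  | succ s ih =>
    intro y hy1 hy n hn
    rcases n with _ | n
    · simp
    have hgt : Rr p 1 < ‖1 - y‖ := by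
      refine lt_of_lt_of_le (lt_of_le_of_lt (Rr_monotone hp1 (Nat.le_add_left 1 s)) ?_) hy
      rw [← Rr_succ_succ_pow hp1 s]
      exact pow_lt_self_of_lt_one₀ (Rr_succ_pos hp1 _) (Rr_lt_one hp1 _) hp1
    have h := norm_one_sub_pow_prime_of_gt hp hpn hy1 hgt
    rw [pow_succ', pow_mul, ih (y ^ p) ?_ ?_ n (by omega), h, ← pow_mul]
    · rw [h]
      exact pow_lt_one₀ (norm_nonneg _) hy1 hp.ne_zero
    · rw [h, ← Rr_succ_succ_pow hp1 s]
      exact pow_le_pow_left₀ (Rr_succ_pos hp1 _).le hy p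

/-- `p`-power roots of unity at distance less than `R(s+1)` from `1` have order dividing `p ^ s`. -/
lemma pow_eq_one_of_mem_GammaR (hp : p.Prime) (hpn : ‖(p : K)‖ = (p : ℝ)⁻¹) {γ : K}
    (hγ : γ ∈ GammaR p K) {s : ℕ} (h : ‖1 - γ‖ < Rr p (s + 1)) : γ ^ p ^ s = 1 := by
  obtain ⟨k, hk⟩ := hγ
  have h1 := norm_one_sub_pow_pow_of_lt hp hpn k _ (norm_one_sub_pow_pow_lt hp hpn s γ h)
  rw [← pow_mul, mul_comm, pow_mul, hk, one_pow, sub_self, norm_zero, eq_comm] at h1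
  have hp0 : ((p : ℝ)⁻¹) ^ k ≠ 0 := pow_ne_zero _ (inv_ne_zero (by exact_mod_cast hp.ne_zero))
  exact (sub_eq_zero.mp (norm_eq_zero.mp ((mul_eq_zero.mp h1).resolve_left hp0))).symm

lemma norm_one_sub_pow_of_coprime {y : K} (hy : ‖1 - y‖ < 1) {l : ℕ} (hl : ‖(l : K)‖ = 1) :
    ‖1 - y ^ l‖ = ‖1 - y‖ := by
  have hy1 : ‖y‖ ≤ 1 := by
    have := IsUltrametricDist.norm_add_le_max (1 : K) (-(1 - y))
    rw [norm_neg, norm_one, max_eq_left hy.le] at this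
    simpa using this
  have hdiff : ‖∑ i ∈ Finset.range l, (y ^ i - 1)‖ ≤ ‖1 - y‖ := by
    refine IsUltrametricDist.norm_sum_le_of_forall_le_of_nonneg (norm_nonneg _) fun i _ => ?_
    rw [← geom_sum_mul, norm_mul, norm_sub_rev]
    refine mul_le_of_le_one_left (norm_nonneg _)
      (IsUltrametricDist.norm_sum_le_of_forall_le_of_nonneg zero_le_one fun j _ => ?_)
    rw [norm_pow]
    exact pow_le_one₀ (norm_nonneg _) hy1
  have hgeom : ‖∑ i ∈ Finset.range l, y ^ i‖ = 1 := by
    have : ∑ i ∈ Finset.range l, y ^ i = (l : K) + ∑ i ∈ Finset.range l, (y ^ i - 1) := by simp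
    rw [this, IsUltrametricDist.norm_add_eq_max_of_norm_ne_norm
      (by rw [hl]; exact (hdiff.trans_lt hy).ne'), hl]
    exact max_eq_left (hdiff.trans hy.le)
  rw [norm_sub_rev, ← geom_sum_mul, norm_mul, hgeom, one_mul, norm_sub_rev]

end Arithmetic

section RadiusBounds

variable {p : ℕ} {K : Type*} [NontriviallyNormedField K]

lemma rQuad_pos (hp : 1 < p) {lam γ₀ : K} (hA : 0 < ‖1 - lam‖) (hB : 0 < ‖γ₀ - lam‖) (s t : ℕ) :
    0 < rQuad p lam γ₀ 1 s t := by
  have h0 : (0 : ℝ) < p := by exact_mod_cast hp.le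
  have hR := Rr_succ_pos hp s
  simp only [rQuad, rTilde, pow_one]
  positivity

lemma log_rQuad (hp : 1 < p) {lam γ₀ : K} (hA : 0 < ‖1 - lam‖) (hB : 0 < ‖γ₀ - lam‖) (s t : ℕ) :
    Real.log (rQuad p lam γ₀ 1 s t) =
      (s * ((p : ℝ) - 1) - 1) / p * Real.log ‖1 - lam‖
        - Real.log p / ((p : ℝ) ^ s * ((p : ℝ) - 1)) - (s - t) / (p : ℝ) ^ s * Real.log p
        + (p : ℝ) ^ t / (p : ℝ) ^ s * Real.log ‖γ₀ - lam‖ := by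
  have h0 : (0 : ℝ) < p := by exact_mod_cast hp.le
  have hR := Rr_succ_pos hp s
  simp only [rQuad, rTilde, pow_one, Nat.cast_one, one_mul, div_one, Real.rpow_one]
  rw [Real.log_mul (by positivity) (by positivity), Real.log_mul (by positivity) (by positivity),
    Real.log_mul (by positivity) (by positivity), Real.log_mul (by positivity) (by positivity),
    Real.log_rpow hA, Real.log_rpow h0, Real.log_rpow hA, Real.log_rpow hB, log_Rr_succ hp,
    Real.rpow_sub h0, Real.rpow_natCast, Real.rpow_natCast, one_div_div]
  ring

/-- Comparison of `r(f) ^ (p ^ s)` with the lower bound for `|1 - λ ^ (p ^ s)|`. -/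
lemma rQuad_pow_lt (hp : 3 ≤ p) {lam γ₀ : K} (hA : 1 / (p : ℝ) < ‖1 - lam‖) (hA1 : ‖1 - lam‖ < 1)
    (hB : 0 < ‖γ₀ - lam‖) {s t : ℕ} (hts : t ≤ s) :
    rQuad p lam γ₀ 1 s t ^ p ^ s < ((p : ℝ)⁻¹) ^ (s - t) * ‖γ₀ - lam‖ ^ p ^ t := by
  have hp1 : 1 < p := by omega
  have h3 : (3 : ℝ) ≤ p := by exact_mod_cast hp
  have h0 : (0 : ℝ) < p := by linarith
  have hA0 : 0 < ‖1 - lam‖ := lt_trans (by positivity) hA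
  have hr := rQuad_pos hp1 hA0 hB s t
  have hL : 0 < Real.log p := Real.log_pos (by linarith)
  have hlogA : Real.log ‖1 - lam‖ < 0 := Real.log_neg hA0 hA1
  have hlogA' : -Real.log p < Real.log ‖1 - lam‖ := by
    rw [← Real.log_inv]
    exact Real.log_lt_log (by positivity) (by simpa using hA)
  rw [← Real.log_lt_log_iff (by positivity) (by positivity), Real.log_pow,
    Real.log_mul (by positivity) (by positivity), Real.log_pow, Real.log_pow, Real.log_inv,
    log_rQuad hp1 hA0 hB]
  push_cast [Nat.cast_sub hts]
  have hps : (0 : ℝ) < (p : ℝ) ^ s := by positivity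
  have hpm : (0 : ℝ) < (p : ℝ) - 1 := by linarith
  have key : (p : ℝ) ^ s * ((s * ((p : ℝ) - 1) - 1) / p * Real.log ‖1 - lam‖)
      - Real.log p / ((p : ℝ) - 1) < 0 := by
    rcases Nat.eq_zero_or_pos s with rfl | hs
    · have h1 : -Real.log ‖1 - lam‖ / p < Real.log p / p := by gcongr; linarith
      have h2 : Real.log p / p ≤ Real.log p / ((p : ℝ) - 1) := by gcongr; linarith
      simp only [pow_zero, Nat.cast_zero, zero_mul, zero_sub, one_mul]
      have : -1 / (p : ℝ) * Real.log ‖1 - lam‖ = -Real.log ‖1 - lam‖ / p := by ring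
      linarith
    · have hs1 : (1 : ℝ) ≤ s := by exact_mod_cast hs
      have h1 : 0 ≤ (s * ((p : ℝ) - 1) - 1) / p := by
        apply div_nonneg _ h0.le
        nlinarith
      have h2 : (p : ℝ) ^ s * ((s * ((p : ℝ) - 1) - 1) / p * Real.log ‖1 - lam‖) ≤ 0 :=
        mul_nonpos_of_nonneg_of_nonpos hps.le (mul_nonpos_of_nonneg_of_nonpos h1 hlogA.le)
      have h3 : 0 < Real.log p / ((p : ℝ) - 1) := by positivity
      linarith
  have hexp : (p : ℝ) ^ s * ((s * ((p : ℝ) - 1) - 1) / p * Real.log ‖1 - lam‖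
        - Real.log p / ((p : ℝ) ^ s * ((p : ℝ) - 1)) - (s - t) / (p : ℝ) ^ s * Real.log p
        + (p : ℝ) ^ t / (p : ℝ) ^ s * Real.log ‖γ₀ - lam‖)
      = ((p : ℝ) ^ s * ((s * ((p : ℝ) - 1) - 1) / p * Real.log ‖1 - lam‖)
      - Real.log p / ((p : ℝ) - 1)) - (s - t) * Real.log p
        + (p : ℝ) ^ t * Real.log ‖γ₀ - lam‖ := by
    field_simp
  rw [hexp]
  linarith

lemma rQuad_lt_norm_one_sub (hp : 3 ≤ p) {lam γ₀ : K} (hA1 : ‖1 - lam‖ < 1)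
    (hB : 0 < ‖γ₀ - lam‖) {s t : ℕ} (hts : t ≤ s + 1) (hA : Rr p (s + 1) ≤ ‖1 - lam‖)
    (ht : ‖γ₀ - lam‖ < Rr p (t + 1)) :
    rQuad p lam γ₀ 1 (s + 1) t < ‖1 - lam‖ := by
  have hp1 : 1 < p := by omega
  have h3 : (3 : ℝ) ≤ p := by exact_mod_cast hp
  have h0 : (0 : ℝ) < p := by linarith
  have hpm : (0 : ℝ) < (p : ℝ) - 1 := by linarith
  have hA0 : 0 < ‖1 - lam‖ := (Rr_succ_pos hp1 s).trans_le hA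
  have hL : 0 < Real.log p := Real.log_pos (by linarith)
  have hlogA : Real.log ‖1 - lam‖ < 0 := Real.log_neg hA0 hA1
  have hlogB := Real.log_lt_log hB ht
  have hlogA' := Real.log_le_log (Rr_succ_pos hp1 s) hA
  rw [log_Rr_succ hp1] at hlogB hlogA'
  rw [← Real.log_lt_log_iff (rQuad_pos hp1 hA0 hB _ _) hA0, log_rQuad hp1 hA0 hB]
  have hts' : (t : ℝ) ≤ s + 1 := by exact_mod_cast hts
  set P : ℝ := (p : ℝ) ^ (s + 1) with hP
  have hP0 : 0 < P := by positivity
  set M : ℝ := Real.log p / (P * ((p : ℝ) - 1)) with hM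
  have hBM : (p : ℝ) ^ t / P * Real.log ‖γ₀ - lam‖ < -M := by
    calc (p : ℝ) ^ t / P * Real.log ‖γ₀ - lam‖
        < (p : ℝ) ^ t / P * -(Real.log p / ((p : ℝ) ^ t * ((p : ℝ) - 1))) := by gcongr
      _ = -M := by rw [hM]; field_simp
  have hAM : -M ≤ 1 / p * Real.log ‖1 - lam‖ := by
    calc -M = 1 / p * -(Real.log p / ((p : ℝ) ^ s * ((p : ℝ) - 1))) := by
          rw [hM, hP]; field_simp; ring
      _ ≤ _ := by gcongr
  have hst : 0 ≤ (((s + 1 : ℕ) : ℝ) - t) / P * Real.log p := by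
    push_cast
    have : 0 ≤ (s : ℝ) + 1 - t := by linarith
    positivity
  have hcoef : (1 : ℝ) ≤ (((s + 1 : ℕ) : ℝ) * ((p : ℝ) - 1) - 1) / p + 1 / p + 1 / p := by
    rw [← add_div, ← add_div, le_div_iff₀ h0]
    push_cast
    have : 0 ≤ (s : ℝ) * (p - 1) := by positivity
    nlinarith
  nlinarith

end RadiusBounds

/-- The multiplier `λ ^ (p ^ n)` stays away from `1` at the scale of the sphere of radius `r(f)`. -/
lemma rQuad_pow_lt_norm_one_sub_pow {p : ℕ} (hp : p.Prime) (hp3 : 3 ≤ p)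
    {K : Type*} [NontriviallyNormedField K] [IsUltrametricDist K] [IsAlgClosed K]
    (hpn : ‖(p : K)‖ = (p : ℝ)⁻¹) {lam γ₀ : K} (hroot : ∀ n : ℕ, 1 ≤ n → lam ^ n ≠ 1)
    (hlam1 : 1 / (p : ℝ) < ‖1 - lam‖) (hlam2 : ‖1 - lam‖ < 1) {s t : ℕ}
    (hs : Rr p s ≤ ‖1 - lam‖ ∧ ‖1 - lam‖ < Rr p (s + 1)) (hγ₀ : γ₀ ∈ GammaR p K)
    (hγmin : ∀ γ ∈ GammaR p K, ‖γ₀ - lam‖ ≤ ‖γ - lam‖)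
    (ht : Rr p t ≤ ‖γ₀ - lam‖ ∧ ‖γ₀ - lam‖ < Rr p (t + 1)) (n : ℕ) :
    rQuad p lam γ₀ 1 s t ^ p ^ n < ‖1 - lam ^ p ^ n‖ := by
  have hp1 := hp.one_lt
  obtain ⟨k, hk⟩ := hγ₀
  have hB : 0 < ‖γ₀ - lam‖ := norm_pos_iff.mpr <| sub_ne_zero.mpr fun h =>
    hroot (p ^ k) (Nat.one_le_pow _ _ hp.pos) (h ▸ hk)
  have hBA : ‖γ₀ - lam‖ ≤ ‖1 - lam‖ := hγmin 1 ⟨0, by simp⟩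
  have hA0 : 0 < ‖1 - lam‖ := hB.trans_le hBA
  have hts : t ≤ s := by
    by_contra! h
    exact absurd (Rr_monotone hp1 (Nat.succ_le_of_lt h)) (not_le.mpr
      ((ht.1.trans hBA).trans_lt hs.2))
  have hr := rQuad_pos hp1 hA0 hB s t
  rcases lt_or_ge n s with hn | hn
  · obtain ⟨s, rfl⟩ := Nat.exists_eq_add_one_of_ne_zero (Nat.ne_zero_of_lt hn)
    rw [norm_one_sub_pow_pow_of_ge hp hpn s lam hlam2 hs.1 n (by omega)]
    exact pow_lt_pow_left₀ (rQuad_lt_norm_one_sub hp3 hlam2 hB hts hs.1 ht.2) hr.le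
      (pow_ne_zero _ hp.ne_zero)
  · obtain ⟨j, rfl⟩ := Nat.exists_eq_add_of_le hn
    have hγs : γ₀ ^ p ^ s = 1 := by
      refine pow_eq_one_of_mem_GammaR hp hpn ⟨k, hk⟩ (lt_of_le_of_lt ?_ hs.2)
      have := IsUltrametricDist.norm_add_le_max (1 - lam) (-(γ₀ - lam))
      rw [norm_neg, max_eq_left hBA] at this
      simpa using this
    have hγ0 : γ₀ ≠ 0 := by
      rintro rfl
      simp [hp.ne_zero] at hk
    have hγ1 : ‖γ₀‖ = 1 := (pow_eq_one_iff_of_nonneg (norm_nonneg _)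
      (pow_ne_zero s hp.ne_zero)).mp (by rw [← norm_pow, hγs, norm_one])
    set μ : K := lam / γ₀ with hμ
    have hdist : ∀ ζ : K, ‖ζ - μ‖ = ‖ζ * γ₀ - lam‖ := fun ζ => by
      rw [← mul_one ‖ζ - μ‖, ← hγ1, ← norm_mul, sub_mul, hμ, div_mul_cancel₀ _ hγ0]
    have hμ1 : ‖1 - μ‖ < Rr p (t + 1) := by
      rw [hdist, one_mul]
      exact ht.2
    have hlow : ‖γ₀ - lam‖ ^ p ^ t ≤ ‖1 - μ ^ p ^ t‖ := by
      refine pow_le_norm_one_sub_pow_pow hp hB.le (fun ζ hζ => ?_) t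
      obtain ⟨i, hi⟩ := hζ
      rw [hdist]
      refine hγmin _ ⟨i + k, ?_⟩
      rw [mul_pow, pow_add, pow_mul, hi, one_pow, mul_comm (p ^ i), pow_mul, hk, one_pow, one_mul]
    have hμt := norm_one_sub_pow_pow_lt hp hpn t μ hμ1
    have hμs : μ ^ p ^ (s + j) = lam ^ p ^ (s + j) := by
      rw [hμ, div_pow, pow_add p s j, pow_mul γ₀, hγs, one_pow, div_one]
    have hval : ‖1 - lam ^ p ^ (s + j)‖
        = ((p : ℝ)⁻¹) ^ j * (((p : ℝ)⁻¹) ^ (s - t) * ‖1 - μ ^ p ^ t‖) := by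
      rw [← hμs, show s + j = t + (s - t + j) by omega, pow_add p t, pow_mul,
        norm_one_sub_pow_pow_of_lt hp hpn _ _ hμt, pow_add]
      ring
    have hp0 : (0 : ℝ) < (p : ℝ)⁻¹ := by simpa using hp.pos
    have hpinv : (p : ℝ)⁻¹ ≤ 1 := inv_le_one_of_one_le₀ (by exact_mod_cast hp1.le)
    set X : ℝ := ((p : ℝ)⁻¹) ^ (s - t) * ‖γ₀ - lam‖ ^ p ^ t with hX
    have hX0 : 0 < X := by positivity
    have hXR : X < Rr p 1 :=
      (mul_le_of_le_one_left (by positivity) (pow_le_one₀ hp0.le hpinv)).trans_lt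
        (hlow.trans_lt hμt)
    calc rQuad p lam γ₀ 1 s t ^ p ^ (s + j)
        = (rQuad p lam γ₀ 1 s t ^ p ^ s) ^ p ^ j := by rw [← pow_mul, pow_add]
      _ < X ^ p ^ j := pow_lt_pow_left₀ (rQuad_pow_lt hp3 hlam1 hlam2 hB hts) (by positivity)
          (pow_ne_zero _ hp.ne_zero)
      _ ≤ ((p : ℝ)⁻¹) ^ j * X := pow_pow_le_of_lt_Rr_one hp1 hX0 hXR j
      _ ≤ _ := by
        rw [hval, hX]
        gcongr

/-- Corollary C: no periodic points on the boundary of the linearization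
disk. For `p ≥ 3`, `1/p < |1-λ| < 1`, and `f(x) = λx + Σ_{i≥2} aᵢxⁱ ∈ 𝒪_p[[x]]` with
`|a₂| = 1` and `|a₂² - a₃| = 1`, no point of the sphere of radius
`r(f) = |1-λ|^{-1/p}·r̃(λ)` is periodic for `f`. -/
theorem stmt3 (p : ℕ) [Fact p.Prime] (hp3 : 3 ≤ p)
    {K : Type*} [NontriviallyNormedField K] [IsUltrametricDist K] [CompleteSpace K]
    [IsAlgClosed K] [Algebra ℚ_[p] K]
    (hiso : ∀ x : ℚ_[p], ‖algebraMap ℚ_[p] K x‖ = ‖x‖)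
    (hdense : Dense {x : K | IsAlgebraic ℚ_[p] x})
    (lam : K) (hroot : ∀ n : ℕ, 1 ≤ n → lam ^ n ≠ 1)
    (hlam1 : 1 / (p : ℝ) < ‖1 - lam‖) (hlam2 : ‖1 - lam‖ < 1)
    (m : ℕ) (hm : IsLeast {n : ℕ | 1 ≤ n ∧ ‖1 - lam ^ n‖ < 1} m)
    (s : ℕ) (hs : Rr p s ≤ ‖1 - lam ^ m‖ ∧ ‖1 - lam ^ m‖ < Rr p (s + 1))
    (γ₀ : K) (hγ₀ : γ₀ ∈ GammaR p K)
    (hγmin : ∀ γ ∈ GammaR p K, ‖γ₀ - lam ^ m‖ ≤ ‖γ - lam ^ m‖)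
    (t : ℕ) (ht : Rr p t ≤ ‖γ₀ - lam ^ m‖ ∧ ‖γ₀ - lam ^ m‖ < Rr p (t + 1))
    (c : ℕ → K) (hc0 : c 0 = 0) (hc1 : c 1 = lam) (hc : ∀ i, ‖c i‖ ≤ 1)
    (hc2 : ‖c 2‖ = 1) (hc3 : ‖c 2 ^ 2 - c 3‖ = 1) :
    ∀ x : K, ‖x‖ = rQuad p lam γ₀ m s t → ∀ n : ℕ, 1 ≤ n → (pEval c)^[n] x ≠ x := by
  have hp : p.Prime := Fact.out
  have hcast : ∀ l : ℕ, ‖(l : K)‖ = ‖(l : ℚ_[p])‖ := fun l => by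
    rw [← hiso, map_natCast]
  have hpn : ‖(p : K)‖ = (p : ℝ)⁻¹ := by rw [hcast, Padic.norm_p]
  obtain rfl : m = 1 := le_antisymm (hm.2 ⟨le_rfl, by simpa using hlam2⟩) hm.1.1
  simp only [pow_one] at hs hγmin ht
  have key := rQuad_pow_lt_norm_one_sub_pow hp hp3 hpn hroot hlam1 hlam2 hs hγ₀ hγmin ht
  intro x hx n hn hfix
  have hx1 : ‖x‖ < 1 := by
    have h0 := key 0
    simp only [pow_zero, pow_one] at h0
    exact hx ▸ h0.trans hlam2
  have hx0 : x ≠ 0 := by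
    rintro rfl
    obtain ⟨k, hk⟩ := hγ₀
    refine (rQuad_pos hp.one_lt ?_ ?_ s t).ne (by rw [← hx, norm_zero])
    · exact norm_pos_iff.mpr (sub_ne_zero.mpr fun h => hroot 1 le_rfl (by rw [← h, one_pow]))
    · exact norm_pos_iff.mpr (sub_ne_zero.mpr fun h =>
        hroot (p ^ k) (Nat.one_le_pow _ _ hp.pos) (h ▸ hk))
  have hN : Function.minimalPeriod (pEval c) x ≠ 0 :=
    (Function.IsPeriodicPt.minimalPeriod_pos hn hfix).ne'
  have hle := norm_one_sub_pow_minimalPeriod_le hc hc0 hx1 hx0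
  obtain ⟨k, l, hl, hkl⟩ := Nat.exists_eq_pow_mul_and_not_dvd hN p hp.ne_one
  have hl1 : ‖(l : K)‖ = 1 := by
    rw [hcast, Padic.norm_natCast_eq_one_iff]
    exact (Nat.Prime.coprime_iff_not_dvd hp).mpr hl
  have hpow : ‖1 - lam ^ p ^ k‖ < 1 := by
    rw [← norm_sub_rev, ← geom_sum_mul, norm_mul, norm_sub_rev lam]
    have hlam : ‖lam‖ ≤ 1 := hc1 ▸ hc 1
    refine (mul_le_of_le_one_left (norm_nonneg _)
      (IsUltrametricDist.norm_sum_le_of_forall_le_of_nonneg zero_le_one fun i _ => ?_)).trans_lt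
      hlam2
    rw [norm_pow]
    exact pow_le_one₀ (norm_nonneg _) hlam
  rw [hkl, hc1, pow_mul, norm_one_sub_pow_of_coprime hpow hl1, pow_mul, hx] at hle
  have hl0 : l ≠ 0 := fun h => hl (h ▸ dvd_zero p)
  have hrk : rQuad p lam γ₀ 1 s t ^ p ^ k ≤ 1 :=
    pow_le_one₀ (hx ▸ norm_nonneg x) (hx ▸ hx1.le)
  exact absurd (hle.trans (pow_le_of_le_one (pow_nonneg (hx ▸ norm_nonneg x) _) hrk hl0))
    (not_le.mpr (key k))
end

section
/- Let p ≥ 2, m ≥ 1, k ≥ 2 and s ≥ 1 be integers, and for a positive integer z put δ(z) = (k-1)/z - ⌊(k-1)/z⌋. Then Σ_{j=0}^{s-1} ( ⌊(k-1)/(m p^j)⌋ - ⌊(k-1)/(m p^{j+1})⌋ ) · p^j = s·((k-1)/m)·((p-1)/p) + δ(m p^s)·p^{s-1} - δ(m) - Σ_{s'=1}^{s-1} δ(m p^{s'})·(p^{s'} - p^{s'-1}), where the sum over s' is empty (equal to zero) if s = 1. -/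
open scoped BigOperators

/-- Lemma on the sum `Σ`. For integers `p ≥ 2`, `m ≥ 1`, `k ≥ 2`,
`s ≥ 1` and `δ(z) = (k-1)/z - ⌊(k-1)/z⌋`:
`Σ_{j=0}^{s-1}(⌊(k-1)/(mp^j)⌋ - ⌊(k-1)/(mp^{j+1})⌋)p^j
 = s((k-1)/m)((p-1)/p) + δ(mp^s)p^{s-1} - δ(m) - Σ_{s'=1}^{s-1} δ(mp^{s'})(p^{s'}-p^{s'-1})`. -/
theorem stmt10 (p m k s : ℕ) (hp : 2 ≤ p) (hm : 1 ≤ m) (hk : 2 ≤ k) (hs : 1 ≤ s) :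
    (∑ j ∈ Finset.range s,
        (((((k - 1) / (m * p ^ j) : ℕ) : ℚ) - (((k - 1) / (m * p ^ (j + 1)) : ℕ) : ℚ)) *
          (p : ℚ) ^ j)) =
      (s : ℚ) * (((k : ℚ) - 1) / (m : ℚ)) * (((p : ℚ) - 1) / (p : ℚ)) +
        deltaFrac k (m * p ^ s) * (p : ℚ) ^ (s - 1) - deltaFrac k m -
        ∑ s' ∈ Finset.Icc 1 (s - 1),
          deltaFrac k (m * p ^ s') * ((p : ℚ) ^ s' - (p : ℚ) ^ (s' - 1)) := by
  have hp0 : (p : ℚ) ≠ 0 := by positivity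
  have hm0 : (m : ℚ) ≠ 0 := by positivity
  induction s, hs using Nat.le_induction with
  | base =>
    simp only [deltaFrac, Finset.sum_range_one, zero_add, pow_zero, pow_one, mul_one, tsub_self,
      Finset.Icc_eq_empty_of_lt zero_lt_one, Finset.sum_empty]
    push_cast
    field_simp
    ring
  | succ n hn ih =>
    obtain ⟨n, rfl⟩ := Nat.exists_eq_add_of_le' hn
    rw [Finset.sum_range_succ, ih]
    simp only [Nat.add_sub_cancel]
    rw [Finset.sum_Icc_succ_top (Nat.le_add_left 1 n), Nat.add_sub_cancel]
    simp only [deltaFrac]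
    push_cast
    field_simp
    ring
end
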